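/- arXiv:1510.07732 — 4 statements merged into one kernel-verified Lean document; each statement's English description precedes it below -/
import Mathlib

section
/- Let g > 0, c ∈ ℝ, and ξ, η < 0 be real numbers. Define the holomorphic normal form symbols B^h(ξ,η) = −(i/2)(ξ+η) + i(c²/(4g))(ξ+η)²/(ξη) − i(c⁴/(8g²))(ξ+η)/(ξη), C^h(ξ,η) = −i(c²/(8g²))(ξ+η), F^h(ξ,η) = i c/4 − i(c³/(8g))(ξ+η)/(ξη), H^h(ξ,η) = −i(c/(4g))(ξ+η), A^h(ξ,η) = −iη + i(c²/(2g))·η/ξ + i c²/(4g), and D^h(ξ,η) = i(c³/(4g²))(ξ+η)/ξ − i(c/(2g))(ξ+η). Then the following six identities hold at (ξ,η): (1) 2η·B^h − 2g·C^h + c·D^h − (ξ+η)·A^h = 0; (2) 2c·C^h + [ξD^h]_sym − (ξ+η)·H^h = 0; (3) g·[D^h]_sym + (ξ+η)·F^h = −i(c/4)(ξ+η); (4) 2η·F^h − 2g·H^h + g·D^h = i(c/2)η; (5) c·H^h + [ξA^h]_sym + g·C^h = −iξη; (6) g·[A^h]_sym − g·B^h + c·F^h = 0. -/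
open Complex

/-- Holomorphic normal form symbol `B^h`. -/
noncomputable def Bh (g c ξ η : ℝ) : ℂ :=
  -(I/2) * ((ξ:ℂ) + η) + I * ((c:ℂ)^2/(4*g)) * ((ξ:ℂ) + η)^2 / ((ξ:ℂ)*η)
    - I * ((c:ℂ)^4/(8*(g:ℂ)^2)) * ((ξ:ℂ) + η) / ((ξ:ℂ)*η)

/-- Holomorphic normal form symbol `C^h`. -/
noncomputable def Ch (g c ξ η : ℝ) : ℂ :=
  -I * ((c:ℂ)^2/(8*(g:ℂ)^2)) * ((ξ:ℂ) + η)

/-- Holomorphic normal form symbol `F^h`. -/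
noncomputable def Fh (g c ξ η : ℝ) : ℂ :=
  I * (c:ℂ)/4 - I * ((c:ℂ)^3/(8*g)) * ((ξ:ℂ) + η) / ((ξ:ℂ)*η)

/-- Holomorphic normal form symbol `H^h`. -/
noncomputable def Hh (g c ξ η : ℝ) : ℂ :=
  -I * ((c:ℂ)/(4*g)) * ((ξ:ℂ) + η)

/-- Holomorphic normal form symbol `A^h`. -/
noncomputable def Ah (g c ξ η : ℝ) : ℂ :=
  -I * (η:ℂ) + I * ((c:ℂ)^2/(2*g)) * (η:ℂ)/(ξ:ℂ) + I * (c:ℂ)^2/(4*g)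

/-- Holomorphic normal form symbol `D^h`. -/
noncomputable def Dh (g c ξ η : ℝ) : ℂ :=
  I * ((c:ℂ)^3/(4*(g:ℂ)^2)) * ((ξ:ℂ) + η)/(ξ:ℂ) - I * ((c:ℂ)/(2*g)) * ((ξ:ℂ) + η)

/-- The six matching conditions satisfied by the holomorphic normal form symbols.
Here `[f]_sym (ξ,η) = (f ξ η + f η ξ)/2` and `[ξ f]_sym (ξ,η) = (ξ • f ξ η + η • f η ξ)/2`. -/
theorem holomorphic_normal_form_symbol_identities
    (g c ξ η : ℝ) (hg : 0 < g) (hξ : ξ < 0) (hη : η < 0) :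
    (2*(η:ℂ) * Bh g c ξ η - 2*(g:ℂ) * Ch g c ξ η + (c:ℂ) * Dh g c ξ η
        - ((ξ:ℂ) + η) * Ah g c ξ η = 0) ∧
    (2*(c:ℂ) * Ch g c ξ η + ((ξ:ℂ) * Dh g c ξ η + (η:ℂ) * Dh g c η ξ)/2
        - ((ξ:ℂ) + η) * Hh g c ξ η = 0) ∧
    ((g:ℂ) * ((Dh g c ξ η + Dh g c η ξ)/2) + ((ξ:ℂ) + η) * Fh g c ξ η
        = -I * ((c:ℂ)/4) * ((ξ:ℂ) + η)) ∧
    (2*(η:ℂ) * Fh g c ξ η - 2*(g:ℂ) * Hh g c ξ η + (g:ℂ) * Dh g c ξ η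
        = I * ((c:ℂ)/2) * (η:ℂ)) ∧
    ((c:ℂ) * Hh g c ξ η + ((ξ:ℂ) * Ah g c ξ η + (η:ℂ) * Ah g c η ξ)/2 + (g:ℂ) * Ch g c ξ η
        = -I * (ξ:ℂ) * (η:ℂ)) ∧
    ((g:ℂ) * ((Ah g c ξ η + Ah g c η ξ)/2) - (g:ℂ) * Bh g c ξ η + (c:ℂ) * Fh g c ξ η = 0) := by
  have h1 : (g:ℂ) ≠ 0 := by exact_mod_cast hg.ne'
  have h2 : (ξ:ℂ) ≠ 0 := by exact_mod_cast hξ.ne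
  have h3 : (η:ℂ) ≠ 0 := by exact_mod_cast hη.ne
  unfold Bh Ch Fh Hh Ah Dh
  refine ⟨?_, ?_, ?_, ?_, ?_, ?_⟩ <;> field_simp <;> ring
end

section
/- Let c ∈ ℝ and g > 0. Let w, q : ℝ × ℝ → ℂ be smooth functions of (t, α) satisfying the linearized system w_t + q_α = 0 and q_t + i c q − i g w = 0, and assume that for each t the functions w(t,·), q(t,·) are compactly supported in α, locally uniformly in t. Then the linearized energy E₀(t) = ∫_ℝ g |w(t,α)|² dα + Im ∫_ℝ q(t,α) ∂_α q̄(t,α) dα is independent of t. -/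
open Complex MeasureTheory

lemma aux_zero (F F' : ℝ → ℝ → ℂ) (t₀ r M : ℝ)
    (hd : ∀ t a, HasDerivAt (fun s => F s a) (F' t a) t)
    (hz : ∀ t, |t - t₀| < r → ∀ a, M ≤ |a| → F t a = 0) :
    ∀ t, |t - t₀| < r → ∀ a, M ≤ |a| → F' t a = 0 := by
  intro t ht a ha
  have hev : (fun s => F s a) =ᶠ[nhds t] fun _ => (0:ℂ) := by
    have : ∀ᶠ s in nhds t, |s - t₀| < r :=
      (by fun_prop : Continuous fun s : ℝ => |s - t₀|).continuousAt.eventually_lt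
        continuousAt_const ht
    filter_upwards [this] with s hs using hz s hs a ha
  exact (hd t a).unique ((hasDerivAt_const t (0:ℂ)).congr_of_eventuallyEq hev)

lemma aux_int (f : ℝ → ℂ) (hf : Continuous f) (M : ℝ) (hz : ∀ a, M ≤ |a| → f a = 0) :
    Integrable f := by
  apply hf.integrable_of_hasCompactSupport
  refine HasCompactSupport.intro (isCompact_Icc (a := -M) (b := M)) fun x hx => hz x ?_
  by_contra h
  exact hx (abs_le.1 (not_le.1 h).le)

lemma aux_leibniz (F F' : ℝ → ℝ → ℂ) (t₀ r M : ℝ) (hr : 0 < r)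
    (hF : Continuous fun p : ℝ × ℝ => F p.1 p.2)
    (hF' : Continuous fun p : ℝ × ℝ => F' p.1 p.2)
    (hd : ∀ t a, HasDerivAt (fun s => F s a) (F' t a) t)
    (hz : ∀ t, |t - t₀| < r → ∀ a, M ≤ |a| → F t a = 0) :
    HasDerivAt (fun t => ∫ a, F t a) (∫ a, F' t₀ a) t₀ := by
  have hz' := aux_zero F F' t₀ r M hd hz
  have hFt : ∀ t, Continuous (F t) := fun t =>
    hF.comp (by fun_prop : Continuous fun a : ℝ => (t, a))
  have hFt' : ∀ t, Continuous (F' t) := fun t =>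
    hF'.comp (by fun_prop : Continuous fun a : ℝ => (t, a))
  obtain ⟨C, hC⟩ := ((isCompact_Icc (a := t₀ - r) (b := t₀ + r)).prod
    (isCompact_Icc (a := -M) (b := M))).exists_bound_of_continuousOn hF'.continuousOn
  have ht0 : |t₀ - t₀| < r := by simpa using hr
  refine (hasDerivAt_integral_of_dominated_loc_of_deriv_le (F := F) (F' := F')
    (s := Metric.ball t₀ r) (bound := (Set.Icc (-M) M).indicator fun _ => C)
    (Metric.ball_mem_nhds _ hr)
    (Filter.Eventually.of_forall fun t => (hFt t).aestronglyMeasurable)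
    (aux_int _ (hFt t₀) M (hz t₀ ht0)) (hFt' t₀).aestronglyMeasurable ?_ ?_ ?_).2
  · refine Filter.Eventually.of_forall fun a t ht => ?_
    rw [Metric.mem_ball, Real.dist_eq] at ht
    by_cases ha : a ∈ Set.Icc (-M) M
    · rw [Set.indicator_of_mem ha]
      have := abs_lt.1 ht
      exact hC (t, a) ⟨⟨by linarith, by linarith⟩, ha⟩
    · rw [Set.indicator_of_notMem ha, hz' t ht a, norm_zero]
      by_contra h
      exact ha (abs_le.1 (not_le.1 h).le)
  · exact (integrable_indicator_iff measurableSet_Icc).2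
      (continuousOn_const.integrableOn_compact isCompact_Icc)
  · exact Filter.Eventually.of_forall fun a t _ => hd t a

/-- Conservation of the linearized energy
`E₀(t) = ∫ g|w|² dα + Im ∫ q ∂_α q̄ dα`
for smooth, compactly supported (locally uniformly in time) solutions of the
linearized water wave system `w_t + q_α = 0`, `q_t + i c q − i g w = 0`. -/
theorem linearized_energy_conserved
    (c g : ℝ) (hg : 0 < g) (w q : ℝ → ℝ → ℂ)
    (hw : ContDiff ℝ (⊤ : ℕ∞) (fun p : ℝ × ℝ => w p.1 p.2))
    (hq : ContDiff ℝ (⊤ : ℕ∞) (fun p : ℝ × ℝ => q p.1 p.2))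
    (hsupp : ∀ t₀ : ℝ, ∃ r > (0:ℝ), ∃ M > (0:ℝ), ∀ t : ℝ, |t - t₀| < r →
        ∀ α : ℝ, M ≤ |α| → w t α = 0 ∧ q t α = 0)
    (h1 : ∀ t α : ℝ, deriv (fun s => w s α) t + deriv (fun β => q t β) α = 0)
    (h2 : ∀ t α : ℝ, deriv (fun s => q s α) t + Complex.I * (c:ℂ) * q t α
          - Complex.I * (g:ℂ) * w t α = 0) :
    ∀ t₁ t₂ : ℝ,
      (∫ α : ℝ, g * Complex.normSq (w t₁ α))
          + (∫ α : ℝ, q t₁ α * deriv (fun β => (starRingEnd ℂ) (q t₁ β)) α).im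
        = (∫ α : ℝ, g * Complex.normSq (w t₂ α))
          + (∫ α : ℝ, q t₂ α * deriv (fun β => (starRingEnd ℂ) (q t₂ β)) α).im := by
  have hs : ∀ (u : ℝ → ℝ → ℂ), Differentiable ℝ (fun p : ℝ × ℝ => u p.1 p.2) → ∀ t a,
      HasDerivAt (fun s => u s a) (fderiv ℝ (fun p : ℝ × ℝ => u p.1 p.2) (t, a) (1, 0)) t := by
    intro u hu t a
    exact (hu (t, a)).hasFDerivAt.comp_hasDerivAt t
      ((hasDerivAt_id t).prodMk (hasDerivAt_const t a))
  have hx : ∀ (u : ℝ → ℝ → ℂ), Differentiable ℝ (fun p : ℝ × ℝ => u p.1 p.2) → ∀ t a,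
      HasDerivAt (fun b => u t b) (fderiv ℝ (fun p : ℝ × ℝ => u p.1 p.2) (t, a) (0, 1)) a := by
    intro u hu t a
    exact (hu (t, a)).hasFDerivAt.comp_hasDerivAt a
      ((hasDerivAt_const a t).prodMk (hasDerivAt_id a))
  have hwd : Differentiable ℝ (fun p : ℝ × ℝ => w p.1 p.2) := hw.differentiable (by simp)
  have hqd : Differentiable ℝ (fun p : ℝ × ℝ => q p.1 p.2) := hq.differentiable (by simp)
  have hq1 : ContDiff ℝ 1 (fderiv ℝ (fun p : ℝ × ℝ => q p.1 p.2)) :=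
    hq.fderiv_right (by norm_cast)
  have hw1 : Continuous (fderiv ℝ (fun p : ℝ × ℝ => w p.1 p.2)) :=
    hw.continuous_fderiv (by simp)
  set DQ := fderiv ℝ (fun p : ℝ × ℝ => q p.1 p.2) with hDQ
  set DW := fderiv ℝ (fun p : ℝ × ℝ => w p.1 p.2) with hDW
  have hDQd : Differentiable ℝ DQ := hq1.differentiable (by simp)
  have hDQc : Continuous DQ := hq1.continuous
  have hwt : ∀ t a, HasDerivAt (fun s => w s a) (-(DQ (t, a) (0, 1))) t := by
    intro t a
    have := h1 t a
    rw [(hx q hqd t a).deriv] at this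
    rw [← eq_neg_of_add_eq_zero_left this]
    exact (hs w hwd t a).differentiableAt.hasDerivAt
  have hqt' : ∀ t a, DQ (t, a) (1, 0) = -(I * c * q t a) + I * g * w t a := by
    intro t a
    have := h2 t a
    rw [(hs q hqd t a).deriv] at this
    linear_combination this
  have hqt : ∀ t a, HasDerivAt (fun s => q s a) (-(I * c * q t a) + I * g * w t a) t := by
    intro t a
    rw [← hqt']
    exact hs q hqd t a
  have hqxt : ∀ t a, HasDerivAt (fun s => DQ (s, a) (0, 1))
      (-(I * c * DQ (t, a) (0, 1)) + I * g * DW (t, a) (0, 1)) t := by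
    intro t a
    have e1 : HasDerivAt (fun s => DQ (s, a)) (fderiv ℝ DQ (t, a) (1, 0)) t :=
      (hDQd (t, a)).hasFDerivAt.comp_hasDerivAt t
        ((hasDerivAt_id t).prodMk (hasDerivAt_const t a))
    have e2 : HasDerivAt (fun b => DQ (t, b)) (fderiv ℝ DQ (t, a) (0, 1)) a :=
      (hDQd (t, a)).hasFDerivAt.comp_hasDerivAt a
        ((hasDerivAt_const a t).prodMk (hasDerivAt_id a))
    have e1' := e1.clm_apply (hasDerivAt_const t ((0:ℝ), (1:ℝ)))
    have e2' := e2.clm_apply (hasDerivAt_const a ((1:ℝ), (0:ℝ)))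
    simp only [map_zero, add_zero] at e1' e2'
    have hsym : fderiv ℝ DQ (t, a) (1, 0) (0, 1) = fderiv ℝ DQ (t, a) (0, 1) (1, 0) :=
      (hq.contDiffAt.isSymmSndFDerivAt (by simp; norm_cast)) _ _
    have e3 : HasDerivAt (fun b => DQ (t, b) (1, 0))
        (-(I * c * DQ (t, a) (0, 1)) + I * g * DW (t, a) (0, 1)) a := by
      simp only [hqt']
      exact (((hx q hqd t a).const_mul _).neg).add ((hx w hwd t a).const_mul _)
    rw [← e3.unique e2' |>.symm, ← hsym] at *
    exact e1'
  let F : ℝ → ℝ → ℂ := fun t a =>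
    g * (w t a * star (w t a)) - I * (q t a * star (DQ (t, a) (0, 1)))
  let F' : ℝ → ℝ → ℂ := fun t a =>
    -g * (DQ (t, a) (0, 1) * star (w t a) + q t a * star (DW (t, a) (0, 1)))
  have hwc := hwd.continuous
  have hqc := hqd.continuous
  have hFc : Continuous fun p : ℝ × ℝ => F p.1 p.2 := by
    simp only [F]; fun_prop
  have hFc' : Continuous fun p : ℝ × ℝ => F' p.1 p.2 := by
    simp only [F']; fun_prop
  have hd : ∀ t a, HasDerivAt (fun s => F s a) (F' t a) t := by
    intro t a
    have := (((hwt t a).mul (hwt t a).star).const_mul (g:ℂ)).sub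
      (((hqt t a).mul (hqxt t a).star).const_mul I)
    refine this.congr_deriv ?_
    simp only [F', star_add, star_neg, star_mul', Complex.star_def, Complex.conj_I,
      Complex.conj_ofReal]
    ring_nf
    simp only [I_sq]
    ring
  have hdE : ∀ t, HasDerivAt (fun t => ∫ a, F t a) 0 t := by
    intro t₀
    obtain ⟨r, hr, M, hM, hz⟩ := hsupp t₀
    have hFz : ∀ t, |t - t₀| < r → ∀ a, M ≤ |a| → F t a = 0 := by
      intro t ht a ha
      simp [F, hz t ht a ha]
    have ht0 : |t₀ - t₀| < r := by simpa using hr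
    have hL := aux_leibniz F F' t₀ r M hr hFc hFc' hd hFz
    have h0 : ∫ a, F' t₀ a = 0 := by
      refine integral_eq_zero_of_hasDerivAt_of_integrable
        (f := fun a => -g * (q t₀ a * star (w t₀ a))) ?_ ?_ ?_
      · intro a
        exact ((hx q hqd t₀ a).mul (hx w hwd t₀ a).star).const_mul _
      · exact aux_int _ (hFc'.comp (by fun_prop : Continuous fun a : ℝ => (t₀, a))) M
          (aux_zero F F' t₀ r M hd hFz t₀ ht0)
      · refine aux_int _ ?_ M fun a ha => by simp [hz t₀ ht0 a ha]
        have a1 : Continuous (w t₀) := hwc.comp (by fun_prop : Continuous fun a : ℝ => (t₀, a))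
        have a2 : Continuous (q t₀) := hqc.comp (by fun_prop : Continuous fun a : ℝ => (t₀, a))
        fun_prop
    rwa [h0] at hL
  have key : ∀ t, (∫ α : ℝ, g * Complex.normSq (w t α))
          + (∫ α : ℝ, q t α * deriv (fun β => (starRingEnd ℂ) (q t β)) α).im
          = (∫ a, F t a).re := by
    intro t
    obtain ⟨r, hr, M, hM, hz⟩ := hsupp t
    have ht0 : |t - t| < r := by simpa using hr
    have hpc : Continuous fun a : ℝ => (t, a) := by fun_prop
    have a1 : Continuous (w t) := hwc.comp hpc
    have a2 : Continuous (q t) := hqc.comp hpc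
    have a3 : Continuous fun a => DQ (t, a) := hDQc.comp hpc
    have hder : ∀ a, deriv (fun β => (starRingEnd ℂ) (q t β)) a = star (DQ (t, a) (0, 1)) :=
      fun a => (hx q hqd t a).star.deriv
    simp only [hder, F]
    rw [integral_sub, integral_const_mul I]
    · have : ∀ a, (g:ℂ) * (w t a * star (w t a)) = ((g * normSq (w t a) : ℝ) : ℂ) := by
        intro a
        rw [Complex.star_def, Complex.mul_conj]; push_cast; rfl
      simp only [this]
      rw [integral_complex_ofReal]
      simp
    · exact aux_int _ (by fun_prop) M fun a ha => by simp [hz t ht0 a ha]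
    · exact aux_int _ (by fun_prop) M fun a ha => by simp [hz t ht0 a ha]
  intro t₁ t₂
  rw [key, key, is_const_of_deriv_eq_zero (fun t => (hdE t).differentiableAt)
    (fun t => (hdE t).deriv) t₁ t₂]
end

section
/- Let c ∈ ℝ and g ∈ ℝ. Let w, q : ℝ × ℝ → ℂ be smooth functions of (t, α) satisfying the linearized system w_t + q_α = 0 and q_t + i c q − i g w = 0, and assume that for each t the functions w(t,·), q(t,·) are compactly supported in α, locally uniformly in t. Then the linearized horizontal momentum P₀(t) = ∫_ℝ (1/i)( q̄(t,α) ∂_α w(t,α) − q(t,α) ∂_α w̄(t,α) ) − c |w(t,α)|² dα (equivalently ∫ 2 Im(q̄ w_α) − c|w|² dα) is independent of t. -/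
open Complex MeasureTheory

theorem aux_cons (e e' F : ℝ → ℝ → ℝ)
    (he : Continuous (fun p : ℝ × ℝ => e p.1 p.2))
    (he' : Continuous (fun p : ℝ × ℝ => e' p.1 p.2))
    (hd : ∀ t α, HasDerivAt (fun s => e s α) (e' t α) t)
    (hF : ∀ t α, HasDerivAt (fun β => F t β) (e' t α) α)
    (hsupp : ∀ t₀ : ℝ, ∃ r > (0:ℝ), ∃ M > (0:ℝ), ∀ t : ℝ, |t - t₀| < r →
        ∀ α : ℝ, M ≤ |α| → e t α = 0 ∧ F t α = 0) (t₁ t₂ : ℝ) :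
    (∫ α, e t₁ α) = ∫ α, e t₂ α := by
  have key : ∀ t₀, HasDerivAt (fun t => ∫ α, e t α) 0 t₀ := by
    intro t₀
    obtain ⟨r, hr, M, hM, h⟩ := hsupp t₀
    have hloc : (fun t => ∫ α, e t α) =ᶠ[nhds t₀] fun t => ∫ α in (-M)..M, e t α := by
      filter_upwards [Metric.ball_mem_nhds t₀ hr] with t ht
      rw [Metric.mem_ball, Real.dist_eq] at ht
      symm
      apply intervalIntegral.integral_eq_integral_of_support_subset
      intro α hα
      by_contra hc
      apply hα
      refine (h t ht α ?_).1
      by_contra hlt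
      push Not at hlt
      exact hc ⟨(abs_lt.1 hlt).1, (abs_lt.1 hlt).2.le⟩
    obtain ⟨C, hC⟩ := ((isCompact_Icc (a := t₀ - 1) (b := t₀ + 1)).prod
      (isCompact_Icc (a := -M) (b := M))).exists_bound_of_continuousOn he'.continuousOn
    have hx : ∀ t, Continuous (e t) := fun t => he.comp (by fun_prop : Continuous fun α : ℝ => (t, α))
    have hx' : ∀ t, Continuous (e' t) :=
      fun t => he'.comp (by fun_prop : Continuous fun α : ℝ => (t, α))
    have h0 := (intervalIntegral.hasDerivAt_integral_of_dominated_loc_of_deriv_le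
      (μ := volume) (F := e) (F' := e') (x₀ := t₀) (a := -M) (b := M) (bound := fun _ => C)
      (s := Set.Icc (t₀ - 1) (t₀ + 1)) (Icc_mem_nhds (by linarith) (by linarith))
      (Filter.Eventually.of_forall fun t => (hx t).aestronglyMeasurable)
      ((hx t₀).intervalIntegrable _ _) (hx' t₀).aestronglyMeasurable
      (Filter.Eventually.of_forall fun α hα t ht => by
        rw [Set.uIoc_of_le (by linarith)] at hα
        exact hC (t, α) ⟨ht, hα.1.le, hα.2⟩)
      intervalIntegrable_const
      (Filter.Eventually.of_forall fun α _ t _ => hd t α)).2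
    have h1 : ∫ α in (-M)..M, e' t₀ α = 0 := by
      rw [intervalIntegral.integral_eq_sub_of_hasDerivAt (fun α _ => hF t₀ α)
        ((hx' t₀).intervalIntegrable _ _)]
      rw [(h t₀ (by simpa using hr) M (le_abs_self M)).2,
        (h t₀ (by simpa using hr) (-M) (by rw [abs_neg]; exact le_abs_self M)).2, sub_zero]
    rw [h1] at h0
    exact h0.congr_of_eventuallyEq hloc
  exact is_const_of_deriv_eq_zero (fun t => (key t).differentiableAt) (fun t => (key t).deriv) t₁ t₂

theorem aux_deriv_snd {f : ℝ → ℝ → ℂ} (hf : ContDiff ℝ (⊤ : ℕ∞) (fun p : ℝ × ℝ => f p.1 p.2))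
    (t α : ℝ) : HasDerivAt (fun β => f t β) (fderiv ℝ (fun p : ℝ × ℝ => f p.1 p.2) (t, α) (0, 1)) α :=
  ((hf.differentiable (by simp)) (t, α)).hasFDerivAt.comp_hasDerivAt α
    ((hasDerivAt_const α t).prodMk (hasDerivAt_id α))

theorem aux_deriv_fst {f : ℝ → ℝ → ℂ} (hf : ContDiff ℝ (⊤ : ℕ∞) (fun p : ℝ × ℝ => f p.1 p.2))
    (t α : ℝ) : HasDerivAt (fun s => f s α) (fderiv ℝ (fun p : ℝ × ℝ => f p.1 p.2) (t, α) (1, 0)) t :=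
  HasFDerivAt.comp_hasDerivAt (f := fun s : ℝ => (s, α)) (l := fun p : ℝ × ℝ => f p.1 p.2) t
    ((hf.differentiable (by simp)) (t, α)).hasFDerivAt
    ((hasDerivAt_id t).prodMk (hasDerivAt_const t α))

theorem aux_smooth {f : ℝ → ℝ → ℂ} (hf : ContDiff ℝ (⊤ : ℕ∞) (fun p : ℝ × ℝ => f p.1 p.2))
    (v : ℝ × ℝ) :
    ContDiff ℝ (⊤ : ℕ∞) (fun p : ℝ × ℝ => fderiv ℝ (fun p : ℝ × ℝ => f p.1 p.2) p v) :=
  (hf.fderiv_right (m := (⊤ : ℕ∞)) (by simp)).clm_apply contDiff_const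

theorem aux_symm {f : ℝ → ℝ → ℂ} (hf : ContDiff ℝ (⊤ : ℕ∞) (fun p : ℝ × ℝ => f p.1 p.2))
    (p u v : ℝ × ℝ) :
    fderiv ℝ (fun p : ℝ × ℝ => fderiv ℝ (fun p : ℝ × ℝ => f p.1 p.2) p v) p u =
    fderiv ℝ (fun p : ℝ × ℝ => fderiv ℝ (fun p : ℝ × ℝ => f p.1 p.2) p u) p v := by
  have hd : DifferentiableAt ℝ (fderiv ℝ (fun p : ℝ × ℝ => f p.1 p.2)) p :=
    (hf.fderiv_right (m := (⊤ : ℕ∞)) (by simp)).differentiable (by simp) p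
  have h := (hf.contDiffAt (x := p)).isSymmSndFDerivAt
    (by simp only [minSmoothness_of_isRCLikeNormedField]; exact WithTop.coe_le_coe.2 (le_top : (2 : ℕ∞) ≤ ⊤)) u v
  rw [fderiv_clm_apply hd (by fun_prop), fderiv_clm_apply hd (by fun_prop)]
  simpa using h

/-- Conservation of the linearized horizontal momentum
`P₀(t) = ∫ 2 Im(q̄ w_α) − c|w|² dα`
for smooth, compactly supported (locally uniformly in time) solutions of the
linearized water wave system `w_t + q_α = 0`, `q_t + i c q − i g w = 0`. -/
theorem linearized_momentum_conserved
    (c g : ℝ) (w q : ℝ → ℝ → ℂ)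
    (hw : ContDiff ℝ (⊤ : ℕ∞) (fun p : ℝ × ℝ => w p.1 p.2))
    (hq : ContDiff ℝ (⊤ : ℕ∞) (fun p : ℝ × ℝ => q p.1 p.2))
    (hsupp : ∀ t₀ : ℝ, ∃ r > (0:ℝ), ∃ M > (0:ℝ), ∀ t : ℝ, |t - t₀| < r →
        ∀ α : ℝ, M ≤ |α| → w t α = 0 ∧ q t α = 0)
    (h1 : ∀ t α : ℝ, deriv (fun s => w s α) t + deriv (fun β => q t β) α = 0)
    (h2 : ∀ t α : ℝ, deriv (fun s => q s α) t + Complex.I * (c:ℂ) * q t α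
          - Complex.I * (g:ℂ) * w t α = 0) :
    ∀ t₁ t₂ : ℝ,
      (∫ α : ℝ, 2 * ((starRingEnd ℂ) (q t₁ α) * deriv (fun β => w t₁ β) α).im
          - c * Complex.normSq (w t₁ α))
        = ∫ α : ℝ, 2 * ((starRingEnd ℂ) (q t₂ α) * deriv (fun β => w t₂ β) α).im
          - c * Complex.normSq (w t₂ α) := by
  have hcs : ∀ {f : ℝ → ℂ} {f' : ℂ} {x : ℝ}, HasDerivAt f f' x →
      HasDerivAt (fun y => (starRingEnd ℂ) (f y)) ((starRingEnd ℂ) f') x := fun h => h.star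
  have him : ∀ {f : ℝ → ℂ} {f' : ℂ} {x : ℝ}, HasDerivAt f f' x →
      HasDerivAt (fun y => (f y).im) f'.im x :=
    fun h => imCLM.hasFDerivAt.comp_hasDerivAt _ h
  have hre : ∀ {f : ℝ → ℂ} {f' : ℂ} {x : ℝ}, HasDerivAt f f' x →
      HasDerivAt (fun y => (f y).re) f'.re x :=
    fun h => reCLM.hasFDerivAt.comp_hasDerivAt _ h
  have hns : ∀ {f : ℝ → ℂ} {f' : ℂ} {x : ℝ}, HasDerivAt f f' x →
      HasDerivAt (fun y => normSq (f y)) (2 * ((starRingEnd ℂ) (f x) * f').re) x := by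
    intro f f' x h
    have h' := hre ((hcs h).mul h)
    refine (h'.congr_deriv ?_).congr_of_eventuallyEq (Filter.Eventually.of_forall fun y => ?_)
    · simp; ring
    · simp [normSq_apply]
  obtain ⟨wa, hwa⟩ : ∃ wa : ℝ → ℝ → ℂ, ∀ t α, wa t α =
    fderiv ℝ (fun p : ℝ × ℝ => w p.1 p.2) (t, α) (0, 1) := ⟨_, fun _ _ => rfl⟩
  obtain ⟨qa, hqa⟩ : ∃ qa : ℝ → ℝ → ℂ, ∀ t α, qa t α =
    fderiv ℝ (fun p : ℝ × ℝ => q p.1 p.2) (t, α) (0, 1) := ⟨_, fun _ _ => rfl⟩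
  have swa : ContDiff ℝ (⊤ : ℕ∞) (fun p : ℝ × ℝ => wa p.1 p.2) := by
    simp only [hwa]; exact aux_smooth hw _
  have sqa : ContDiff ℝ (⊤ : ℕ∞) (fun p : ℝ × ℝ => qa p.1 p.2) := by
    simp only [hqa]; exact aux_smooth hq _
  obtain ⟨qaa, hqaa⟩ : ∃ qaa : ℝ → ℝ → ℂ, ∀ t α, qaa t α =
    fderiv ℝ (fun p : ℝ × ℝ => qa p.1 p.2) (t, α) (0, 1) := ⟨_, fun _ _ => rfl⟩
  have sqaa : ContDiff ℝ (⊤ : ℕ∞) (fun p : ℝ × ℝ => qaa p.1 p.2) := by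
    simp only [hqaa]; exact aux_smooth sqa _
  have dw : ∀ t α, HasDerivAt (fun β => w t β) (wa t α) α := fun t α => by
    rw [hwa]; exact aux_deriv_snd hw t α
  have dq : ∀ t α, HasDerivAt (fun β => q t β) (qa t α) α := fun t α => by
    rw [hqa]; exact aux_deriv_snd hq t α
  have dqa : ∀ t α, HasDerivAt (fun β => qa t β) (qaa t α) α := fun t α => by
    rw [hqaa]; exact aux_deriv_snd sqa t α
  have wt : ∀ t α, fderiv ℝ (fun p : ℝ × ℝ => w p.1 p.2) (t, α) (1, 0) = - qa t α := by
    intro t α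
    have := h1 t α
    rw [(aux_deriv_fst hw t α).deriv, (dq t α).deriv] at this
    exact eq_neg_of_add_eq_zero_left this
  have dwt : ∀ t α, HasDerivAt (fun s => w s α) (- qa t α) t := fun t α => by
    rw [← wt]; exact aux_deriv_fst hw t α
  have dqt : ∀ t α, HasDerivAt (fun s => q s α) (- I * c * q t α + I * g * w t α) t := by
    intro t α
    have := h2 t α
    have h := aux_deriv_fst hq t α
    rw [h.deriv] at this
    refine h.congr_deriv ?_
    linear_combination this
  have dwat : ∀ t α, HasDerivAt (fun s => wa s α) (- qaa t α) t := by
    intro t α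
    refine (aux_deriv_fst swa t α).congr_deriv ?_
    simp only [hwa]
    rw [aux_symm hw]
    have : (fun p : ℝ × ℝ => fderiv ℝ (fun p : ℝ × ℝ => w p.1 p.2) p (1, 0)) =
        fun p => - qa p.1 p.2 := funext fun p => wt p.1 p.2
    rw [this, hqaa, fderiv_fun_neg]
    rfl
  have cw := hw.continuous
  have cq := hq.continuous
  have cwa := swa.continuous
  have cqa := sqa.continuous
  have cqaa := sqaa.continuous
  simp only [fun t α => (dw t α).deriv]
  refine aux_cons (fun t α => 2 * ((starRingEnd ℂ) (q t α) * wa t α).im - c * normSq (w t α))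
    (fun t α => 2 * ((starRingEnd ℂ) (- I * c * q t α + I * g * w t α) * wa t α
      + (starRingEnd ℂ) (q t α) * (- qaa t α)).im
      - c * (2 * ((starRingEnd ℂ) (w t α) * (- qa t α)).re))
    (fun t α => 2 * c * ((starRingEnd ℂ) (q t α) * w t α).re - g * normSq (w t α)
      - 2 * ((starRingEnd ℂ) (q t α) * qa t α).im) ?_ ?_ ?_ ?_ ?_
  · have := continuous_normSq.comp cw
    simp only [Function.comp_def] at this
    have hc := continuous_conj.comp cq
    simp only [Function.comp_def] at hc
    exact (continuous_const.mul (continuous_im.comp (hc.mul cwa))).sub (continuous_const.mul this)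
  · have hc := continuous_conj.comp cq
    have hc' := continuous_conj.comp cw
    have hc2 := continuous_conj.comp
      ((continuous_const (y := - I * (c:ℂ))).mul cq |>.add ((continuous_const (y := I * (g:ℂ))).mul cw))
    exact (continuous_const.mul (continuous_im.comp ((hc2.mul cwa).add (hc.mul cqaa.neg)))).sub
      (continuous_const.mul (continuous_const.mul (continuous_re.comp (hc'.mul cqa.neg))))
  · intro t α
    exact ((him ((hcs (dqt t α)).mul (dwat t α))).const_mul 2).sub ((hns (dwt t α)).const_mul c)
  · intro t α
    refine ((((hre ((hcs (dq t α)).mul (dw t α))).const_mul (2 * c)).sub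
      ((hns (dw t α)).const_mul g)).sub
      ((him ((hcs (dq t α)).mul (dqa t α))).const_mul 2)).congr_deriv ?_
    simp
    ring
  · intro t₀
    obtain ⟨r, hr, M, hM, h⟩ := hsupp t₀
    refine ⟨r, hr, M, hM, fun t ht α hα => ?_⟩
    obtain ⟨a, b⟩ := h t ht α hα
    simp [a, b]
end

section
/- Let c, g ∈ ℝ, let Ω ⊆ ℝ³ be open with coordinates (t, x, y), and let φ, θ, p : Ω → ℝ with φ twice continuously differentiable and θ, p continuously differentiable. Assume the Cauchy–Riemann relations φ_x = θ_y and φ_y = −θ_x hold on Ω, and that the velocity field u := c y + φ_x, v := φ_y satisfies the incompressible Euler equations with gravity: u_t + u u_x + v u_y = −p_x and v_t + u v_x + v v_y = −p_y − g on Ω. Then the Bernoulli quantity E := φ_t − c θ + c y φ_x + ½(φ_x² + φ_y²) + g y + p satisfies ∂_x E = 0 and ∂_y E = 0 at every point of Ω. -/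
/-- Partial derivative in the first (time) coordinate of `(t,x,y) ∈ ℝ³`. -/
noncomputable def pt (f : ℝ × ℝ × ℝ → ℝ) (q : ℝ × ℝ × ℝ) : ℝ :=
  deriv (fun s => f (s, q.2.1, q.2.2)) q.1

/-- Partial derivative in the second (horizontal) coordinate of `(t,x,y) ∈ ℝ³`. -/
noncomputable def px (f : ℝ × ℝ × ℝ → ℝ) (q : ℝ × ℝ × ℝ) : ℝ :=
  deriv (fun s => f (q.1, s, q.2.2)) q.2.1

/-- Partial derivative in the third (vertical) coordinate of `(t,x,y) ∈ ℝ³`. -/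
noncomputable def py (f : ℝ × ℝ × ℝ → ℝ) (q : ℝ × ℝ × ℝ) : ℝ :=
  deriv (fun s => f (q.1, q.2.1, s)) q.2.2

theorem slice_t {f : ℝ × ℝ × ℝ → ℝ} {q : ℝ × ℝ × ℝ} {f' : ℝ × ℝ × ℝ →L[ℝ] ℝ}
    (h : HasFDerivAt f f' q) :
    HasDerivAt (fun s => f (s, q.2.1, q.2.2)) (f' (1, 0, 0)) q.1 := by
  have h1 : HasDerivAt (fun s : ℝ => ((s, q.2.1, q.2.2) : ℝ × ℝ × ℝ)) (1, 0, 0) q.1 :=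
    (hasDerivAt_id q.1).prodMk (hasDerivAt_const q.1 (q.2.1, q.2.2))
  exact HasFDerivAt.comp_hasDerivAt q.1 (f := fun s : ℝ => ((s, q.2.1, q.2.2) : ℝ × ℝ × ℝ)) h h1

theorem slice_x {f : ℝ × ℝ × ℝ → ℝ} {q : ℝ × ℝ × ℝ} {f' : ℝ × ℝ × ℝ →L[ℝ] ℝ}
    (h : HasFDerivAt f f' q) :
    HasDerivAt (fun s => f (q.1, s, q.2.2)) (f' (0, 1, 0)) q.2.1 := by
  have h1 : HasDerivAt (fun s : ℝ => ((q.1, s, q.2.2) : ℝ × ℝ × ℝ)) (0, 1, 0) q.2.1 :=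
    (hasDerivAt_const q.2.1 q.1).prodMk
      ((hasDerivAt_id q.2.1).prodMk (hasDerivAt_const q.2.1 q.2.2))
  exact HasFDerivAt.comp_hasDerivAt q.2.1
    (f := fun s : ℝ => ((q.1, s, q.2.2) : ℝ × ℝ × ℝ)) h h1

theorem slice_y {f : ℝ × ℝ × ℝ → ℝ} {q : ℝ × ℝ × ℝ} {f' : ℝ × ℝ × ℝ →L[ℝ] ℝ}
    (h : HasFDerivAt f f' q) :
    HasDerivAt (fun s => f (q.1, q.2.1, s)) (f' (0, 0, 1)) q.2.2 := by
  have h1 : HasDerivAt (fun s : ℝ => ((q.1, q.2.1, s) : ℝ × ℝ × ℝ)) (0, 0, 1) q.2.2 :=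
    (hasDerivAt_const q.2.2 q.1).prodMk
      ((hasDerivAt_const q.2.2 q.2.1).prodMk (hasDerivAt_id q.2.2))
  exact HasFDerivAt.comp_hasDerivAt q.2.2
    (f := fun s : ℝ => ((q.1, q.2.1, s) : ℝ × ℝ × ℝ)) h h1

/-- For a two-dimensional incompressible flow with constant vorticity `−c`,
velocity `u = cy + φ_x`, `v = φ_y`, satisfying the Euler equations with gravity,
the Bernoulli quantity `E = φ_t − cθ + cyφ_x + ½(φ_x² + φ_y²) + gy + p`
has vanishing spatial gradient. -/
theorem bernoulli_spatial_gradient_vanishes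
    (c g : ℝ) (Ω : Set (ℝ × ℝ × ℝ)) (hΩ : IsOpen Ω)
    (φ θ p : ℝ × ℝ × ℝ → ℝ)
    (hφ : ContDiffOn ℝ 2 φ Ω) (hθ : ContDiffOn ℝ 1 θ Ω) (hp : ContDiffOn ℝ 1 p Ω)
    (hCR1 : ∀ q ∈ Ω, px φ q = py θ q)
    (hCR2 : ∀ q ∈ Ω, py φ q = - px θ q)
    (hEuler1 : ∀ q ∈ Ω,
        pt (fun z => c * z.2.2 + px φ z) q
          + (c * q.2.2 + px φ q) * px (fun z => c * z.2.2 + px φ z) q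
          + (py φ q) * py (fun z => c * z.2.2 + px φ z) q = - px p q)
    (hEuler2 : ∀ q ∈ Ω,
        pt (fun z => py φ z) q
          + (c * q.2.2 + px φ q) * px (fun z => py φ z) q
          + (py φ q) * py (fun z => py φ z) q = - py p q - g) :
    ∀ q ∈ Ω,
      px (fun z => pt φ z - c * θ z + c * z.2.2 * px φ z
            + (1/2) * ((px φ z)^2 + (py φ z)^2) + g * z.2.2 + p z) q = 0 ∧
      py (fun z => pt φ z - c * θ z + c * z.2.2 * px φ z
            + (1/2) * ((px φ z)^2 + (py φ z)^2) + g * z.2.2 + p z) q = 0 := by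
  intro q hq
  have hnhds : Ω ∈ nhds q := hΩ.mem_nhds hq
  have hdφ : ∀ z ∈ Ω, HasFDerivAt φ (fderiv ℝ φ z) z := fun z hz =>
    ((hφ.contDiffAt (hΩ.mem_nhds hz)).differentiableAt (by norm_num)).hasFDerivAt
  have hdθ : HasFDerivAt θ (fderiv ℝ θ q) q :=
    ((hθ.contDiffAt hnhds).differentiableAt (by norm_num)).hasFDerivAt
  have hdp : HasFDerivAt p (fderiv ℝ p q) q :=
    ((hp.contDiffAt hnhds).differentiableAt (by norm_num)).hasFDerivAt
  have hφq : ContDiffAt ℝ 2 φ q := hφ.contDiffAt hnhds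
  have hsymm : IsSymmSndFDerivAt ℝ φ q := hφq.isSymmSndFDerivAt (by simp)
  have hD : HasFDerivAt (fderiv ℝ φ) (fderiv ℝ (fderiv ℝ φ) q) q :=
    ((hφq.fderiv_right (m := 1) (by norm_num)).differentiableAt (by norm_num)).hasFDerivAt
  set D := fderiv ℝ (fderiv ℝ φ) q with hDdef
  have key : ∀ e : ℝ × ℝ × ℝ, HasFDerivAt (fun z => fderiv ℝ φ z e) (D.flip e) q := by
    intro e
    have := hD.clm_apply (hasFDerivAt_const e q)
    simpa using this
  have hT : HasFDerivAt (pt φ) (D.flip (1, 0, 0)) q := by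
    refine (key _).congr_of_eventuallyEq ?_
    filter_upwards [hnhds] with z hz using (slice_t (hdφ z hz)).deriv
  have hX : HasFDerivAt (px φ) (D.flip (0, 1, 0)) q := by
    refine (key _).congr_of_eventuallyEq ?_
    filter_upwards [hnhds] with z hz using (slice_x (hdφ z hz)).deriv
  have hY : HasFDerivAt (py φ) (D.flip (0, 0, 1)) q := by
    refine (key _).congr_of_eventuallyEq ?_
    filter_upwards [hnhds] with z hz using (slice_y (hdφ z hz)).deriv
  have e1 := hEuler1 q hq
  have e2 := hEuler2 q hq
  have c1 := hCR1 q hq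
  have c2 := hCR2 q hq
  have a1 : pt (fun z => c * z.2.2 + px φ z) q = D (1, 0, 0) (0, 1, 0) :=
    ((slice_t hX).const_add (c * q.2.2)).deriv
  have a2 : px (fun z => c * z.2.2 + px φ z) q = D (0, 1, 0) (0, 1, 0) :=
    ((slice_x hX).const_add (c * q.2.2)).deriv
  have a3 : py (fun z => c * z.2.2 + px φ z) q = c * 1 + D (0, 0, 1) (0, 1, 0) :=
    (((hasDerivAt_id q.2.2).const_mul c).add (slice_y hX)).deriv
  have b1 : pt (fun z => py φ z) q = D (1, 0, 0) (0, 0, 1) := (slice_t hY).deriv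
  have b2 : px (fun z => py φ z) q = D (0, 1, 0) (0, 0, 1) := (slice_x hY).deriv
  have b3 : py (fun z => py φ z) q = D (0, 0, 1) (0, 0, 1) := (slice_y hY).deriv
  have tx : px θ q = fderiv ℝ θ q (0, 1, 0) := (slice_x hdθ).deriv
  have ty : py θ q = fderiv ℝ θ q (0, 0, 1) := (slice_y hdθ).deriv
  have qx : px p q = fderiv ℝ p q (0, 1, 0) := (slice_x hdp).deriv
  have qy : py p q = fderiv ℝ p q (0, 0, 1) := (slice_y hdp).deriv
  have s1 : D (1, 0, 0) (0, 1, 0) = D (0, 1, 0) (1, 0, 0) := hsymm _ _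
  have s2 : D (1, 0, 0) (0, 0, 1) = D (0, 0, 1) (1, 0, 0) := hsymm _ _
  have s3 : D (0, 1, 0) (0, 0, 1) = D (0, 0, 1) (0, 1, 0) := hsymm _ _
  rw [a1, a2, a3, qx] at e1
  rw [b1, b2, b3, qy] at e2
  rw [ty] at c1
  rw [tx] at c2
  constructor
  · have h := ((((((slice_x hT).sub ((slice_x hdθ).const_mul c)).add
      ((slice_x hX).const_mul (c * q.2.2))).add
      ((((slice_x hX).pow 2).add ((slice_x hY).pow 2)).const_mul (1/2))).add
      (hasDerivAt_const q.2.1 (g * q.2.2))).add (slice_x hdp)).deriv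
    refine Eq.trans h ?_
    simp only [ContinuousLinearMap.flip_apply]
    norm_num
    linear_combination e1 - s1 - c * c2 + py φ q * s3
  · have h := ((((((slice_y hT).sub ((slice_y hdθ).const_mul c)).add
      (((hasDerivAt_id q.2.2).const_mul c).mul (slice_y hX))).add
      ((((slice_y hX).pow 2).add ((slice_y hY).pow 2)).const_mul (1/2))).add
      ((hasDerivAt_id q.2.2).const_mul g)).add (slice_y hdp)).deriv
    refine Eq.trans h ?_
    simp only [ContinuousLinearMap.flip_apply]
    norm_num
    linear_combination e2 - s2 + c * c1 - (c * q.2.2 + px φ q) * s3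
end
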